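/- Let G : ℝ → ℂ be twice continuously differentiable with compact support such that G(u) = 0 for all u > 1, and set Ĝ(ξ) = ∫_ℝ G(u) e^{2πiuξ} du. Then for every integer q ≥ 1, every Dirichlet character χ modulo q, every real x > 1 and every s ∈ ℂ: ∑_{n ≥ 1} χ(n) n^{−s} G(log n / log x) = (log x / 2π) ∫_ℝ ( ∑_{a ≤ x} d_{1/2}(a) χ(a) a^{−s−iv} )² Ĝ(v log x / (2π)) dv, where the integral converges absolutely. -/

import Mathlib

open Complex
open scoped Real

noncomputable section

/-- The multiplicative function `d_{1/2}`, with `d_{1/2}(p^j) = C(2j,j)/4^j`: the Dirichlet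
series coefficients of `ζ(s)^{1/2}`. -/
def dHalf (n : ℕ) : ℝ :=
  if n = 0 then 0
  else ∏ p ∈ n.primeFactors,
    (Nat.choose (2 * n.factorization p) (n.factorization p) : ℝ) / 4 ^ (n.factorization p)

open Finset.HasAntidiagonal in
/-- The sum of `C(2i,i) C(2j,j)` over `i + j = n` is `4 ^ n`. -/
theorem sum_antidiagonal_centralBinom_mul_centralBinom (n : ℕ) :
    ∑ p ∈ antidiagonal n, (p.1.centralBinom : ℝ) * p.2.centralBinom = 4 ^ n := by
  have weighted (n : ℕ) :
      2 * ∑ p ∈ antidiagonal n, (p.1 : ℝ) * (p.1.centralBinom * p.2.centralBinom) =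
        n * ∑ p ∈ antidiagonal n, (p.1.centralBinom : ℝ) * p.2.centralBinom := by
    have swap : ∑ p ∈ antidiagonal n, (p.1 : ℝ) * (p.1.centralBinom * p.2.centralBinom) =
        ∑ p ∈ antidiagonal n, (p.2 : ℝ) * (p.1.centralBinom * p.2.centralBinom) := by
      rw [← Finset.Nat.sum_antidiagonal_swap]
      exact Finset.sum_congr rfl fun p _ => by simp only [Prod.fst_swap, Prod.snd_swap]; ring
    rw [two_mul]
    nth_rw 2 [swap]
    rw [← Finset.sum_add_distrib, Finset.mul_sum]
    refine Finset.sum_congr rfl fun p hp => ?_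
    rw [← mem_antidiagonal.1 hp]
    push_cast
    ring
  induction n with
  | zero => simp
  | succ n ih =>
    have shift : ∑ p ∈ antidiagonal (n + 1),
        (p.1 : ℝ) * (p.1.centralBinom * p.2.centralBinom) =
        ∑ p ∈ antidiagonal n, (2 * (2 * (p.1 : ℝ) + 1)) *
          (p.1.centralBinom * p.2.centralBinom) := by
      rw [Finset.Nat.sum_antidiagonal_succ]
      simp only [Nat.cast_zero, zero_mul, zero_add]
      refine Finset.sum_congr rfl fun p _ => ?_
      have h : ((p.1 : ℝ) + 1) * (p.1 + 1).centralBinom =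
          2 * (2 * p.1 + 1) * p.1.centralBinom := mod_cast Nat.succ_mul_centralBinom_succ p.1
      push_cast
      rw [← mul_assoc, h]
      ring
    have split : ∑ p ∈ antidiagonal n, (2 * (2 * (p.1 : ℝ) + 1)) *
          (p.1.centralBinom * p.2.centralBinom) = (2 * n + 2) * 4 ^ n := by
      have := weighted n
      rw [ih] at this
      have expand : ∑ p ∈ antidiagonal n, (2 * (2 * (p.1 : ℝ) + 1)) *
          (p.1.centralBinom * p.2.centralBinom) =
          4 * ∑ p ∈ antidiagonal n, (p.1 : ℝ) * (p.1.centralBinom * p.2.centralBinom) +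
          2 * ∑ p ∈ antidiagonal n, (p.1.centralBinom : ℝ) * p.2.centralBinom := by
        rw [Finset.mul_sum, Finset.mul_sum, ← Finset.sum_add_distrib]
        exact Finset.sum_congr rfl fun p _ => by ring
      rw [expand, ih]
      linear_combination 2 * this
    have key := weighted (n + 1)
    rw [shift, split] at key
    have hn : ((n + 1 : ℕ) : ℝ) ≠ 0 := by positivity
    apply mul_left_cancel₀ hn
    rw [← key]
    push_cast
    ring

/-- `dHalf` as an arithmetic function. -/
def dHalfArith : ArithmeticFunction ℝ := ⟨dHalf, by simp [dHalf]⟩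

theorem isMultiplicative_dHalfArith : dHalfArith.IsMultiplicative := by
  rw [ArithmeticFunction.IsMultiplicative.iff_ne_zero]
  refine ⟨by simp [dHalfArith, dHalf], fun {m n} hm hn hmn => ?_⟩
  simp only [dHalfArith, ArithmeticFunction.coe_mk, dHalf, hm, hn, mul_eq_zero, or_self, if_false]
  rw [hmn.primeFactors_mul, Finset.prod_union hmn.disjoint_primeFactors]
  congr 1 <;> refine Finset.prod_congr rfl fun p hp => ?_
  · rw [Nat.factorization_eq_of_coprime_left hmn
      (Nat.mem_primeFactors_iff_mem_primeFactorsList.1 hp)]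
  · rw [Nat.factorization_eq_of_coprime_right hmn
      (Nat.mem_primeFactors_iff_mem_primeFactorsList.1 hp)]

theorem dHalf_prime_pow {p : ℕ} (hp : p.Prime) (k : ℕ) :
    dHalf (p ^ k) = (k.centralBinom : ℝ) / 4 ^ k := by
  rcases eq_or_ne k 0 with rfl | hk
  · simp [dHalf]
  · simp [dHalf, hp.ne_zero, Nat.primeFactors_prime_pow hk hp, hp.factorization_self,
      Nat.centralBinom_eq_two_mul_choose]

open ArithmeticFunction in
theorem dHalfArith_mul_self :
    dHalfArith * dHalfArith = (ArithmeticFunction.zeta : ArithmeticFunction ℝ) := by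
  refine ((isMultiplicative_dHalfArith.mul isMultiplicative_dHalfArith).eq_iff_eq_on_prime_powers _
    _ isMultiplicative_zeta.natCast).2 fun p k hp => ?_
  rw [mul_apply, Nat.sum_divisorsAntidiagonal (fun a b => dHalfArith a * dHalfArith b),
    Nat.sum_divisors_prime_pow hp, natCoe_apply, zeta_apply_ne (pow_ne_zero _ hp.ne_zero),
    Nat.cast_one]
  have h := sum_antidiagonal_centralBinom_mul_centralBinom k
  rw [Finset.Nat.sum_antidiagonal_eq_sum_range_succ
    (fun i j => (i.centralBinom : ℝ) * j.centralBinom)] at h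
  rw [← div_self (pow_ne_zero k (four_ne_zero' ℝ))]
  nth_rw 1 [← h]
  rw [Finset.sum_div]
  refine Finset.sum_congr rfl fun i hi => ?_
  have hik : i ≤ k := Nat.lt_succ_iff.1 (Finset.mem_range.1 hi)
  rw [Nat.pow_div hik hp.pos]
  change dHalf _ * dHalf _ = _
  rw [dHalf_prime_pow hp, dHalf_prime_pow hp, div_mul_div_comm, ← pow_add,
    Nat.add_sub_cancel' hik]

/-- The square of the truncation of `dHalf` at `N` has coefficients `1` up to `N`. -/
theorem sum_Icc_sum_Icc_dHalf_mul (N : ℕ) (f : ℕ → ℂ) (hf : ∀ n, N < n → f n = 0) :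
    ∑ a ∈ Finset.Icc 1 N, ∑ b ∈ Finset.Icc 1 N, (dHalf a : ℂ) * dHalf b * f (a * b) =
      ∑ n ∈ Finset.Icc 1 N, f n := by
  have hconv {n : ℕ} (hn : n ≠ 0) :
      ∑ p ∈ n.divisorsAntidiagonal, (dHalf p.1 : ℂ) * dHalf p.2 = 1 := by
    have h := congrArg (fun g : ArithmeticFunction ℝ => g n) dHalfArith_mul_self
    simp only [ArithmeticFunction.mul_apply, ArithmeticFunction.natCoe_apply,
      ArithmeticFunction.zeta_apply_ne hn, Nat.cast_one] at h
    exact_mod_cast congrArg (fun r : ℝ => (r : ℂ)) h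
  symm
  rw [← Finset.sum_product']
  change ∑ n ∈ Finset.Ioc 0 N, f n = ∑ x ∈ Finset.Ioc 0 N ×ˢ Finset.Ioc 0 N, _
  calc ∑ n ∈ Finset.Ioc 0 N, f n
      = ∑ n ∈ Finset.Ioc 0 N, ∑ x ∈ Finset.Ioc 0 N ×ˢ Finset.Ioc 0 N with x.1 * x.2 = n,
          (dHalf x.1 : ℂ) * dHalf x.2 * f (x.1 * x.2) := by
        refine Finset.sum_congr rfl fun n hn => ?_
        obtain ⟨h0, hN⟩ := Finset.mem_Ioc.1 hn
        rw [← Nat.divisorsAntidiagonal_eq_prod_filter_of_le h0.ne' hN]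
        nth_rw 1 [← one_mul (f n), ← hconv h0.ne', Finset.sum_mul]
        exact Finset.sum_congr rfl fun p hp => by rw [(Nat.mem_divisorsAntidiagonal.1 hp).1]
    _ = _ := by
        simp_rw [Finset.sum_filter]
        rw [Finset.sum_comm]
        refine Finset.sum_congr rfl fun x hx => ?_
        rw [Finset.sum_ite_eq]
        split_ifs with h
        · rfl
        · rw [Finset.mem_product, Finset.mem_Ioc, Finset.mem_Ioc] at hx
          rw [Finset.mem_Ioc, not_and, not_le] at h
          rw [hf _ (h (Nat.mul_pos hx.1.1 hx.2.1)), mul_zero]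

open MeasureTheory FourierTransform in
/-- The Fourier transform of a compactly supported `C²` function is integrable. -/
theorem integrable_fourier_of_contDiff_two {G : ℝ → ℂ} (hG : ContDiff ℝ 2 G)
    (hGsupp : HasCompactSupport G) : Integrable (𝓕 G) := by
  have hint (n : ℕ) (hn : (n : ℕ∞) ≤ 2) : Integrable (iteratedDeriv n G) :=
    (hG.continuous_iteratedDeriv n (mod_cast hn)).integrable_of_hasCompactSupport
      ((hGsupp.iteratedFDeriv n).comp_left
        (g := fun T : ℝ [×n]→L[ℝ] ℂ => T fun _ => 1) rfl)
  have h2 := Real.fourier_iteratedDeriv (N := 2) (n := 2) hG hint le_rfl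
  have hG1 : Integrable G := by simpa using hint 0 (by simp)
  have hbound (f : ℝ → ℂ) (w : ℝ) : ‖𝓕 f w‖ ≤ ∫ v, ‖f v‖ :=
    VectorFourier.norm_fourierIntegral_le_integral_norm _ _ _ _ _
  have hcont : Continuous (𝓕 G) :=
    VectorFourier.fourierIntegral_continuous Real.continuous_fourierChar
      (by exact continuous_inner) hG1
  set C := (∫ v, ‖G v‖) + ∫ v, ‖iteratedDeriv 2 G v‖ with hC
  refine (integrable_inv_one_add_sq.const_mul C).mono' hcont.aestronglyMeasurable
    (Filter.Eventually.of_forall fun w => ?_)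
  rw [← div_eq_mul_inv, le_div_iff₀ (by positivity)]
  have h0 := hbound G w
  have h3 := hbound (iteratedDeriv 2 G) w
  rw [h2] at h3
  simp only [norm_smul, norm_pow, norm_mul, Complex.norm_ofNat, Complex.norm_real,
    Complex.norm_I, Real.norm_eq_abs, sq_abs, mul_pow, abs_of_pos Real.pi_pos] at h3
  have hpi : 1 ≤ 2 ^ 2 * π ^ 2 := by nlinarith [Real.pi_gt_three]
  have : w ^ 2 * ‖𝓕 G w‖ ≤ 2 ^ 2 * π ^ 2 * w ^ 2 * ‖𝓕 G w‖ := by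
    rw [mul_assoc (2 ^ 2 * π ^ 2)]
    exact le_mul_of_one_le_left (by positivity) hpi
  rw [hC]
  linarith

open MeasureTheory FourierTransform in
/-- Mellin-type inversion: the integral of `n ^ (-iv)` against the dilated Fourier transform. -/
theorem integrable_and_integral_natCast_cpow_mul {G : ℝ → ℂ} (hG : ContDiff ℝ 2 G)
    (hGsupp : HasCompactSupport G) {Ghat : ℝ → ℂ}
    (hGhat : ∀ ξ : ℝ, Ghat ξ = ∫ u : ℝ, G u * Complex.exp (2 * (π : ℂ) * I * u * ξ))
    {L : ℝ} (hL : 0 < L) {n : ℕ} (hn : n ≠ 0) :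
    Integrable (fun v : ℝ => (n : ℂ) ^ (-(v * I)) * Ghat (v * L / (2 * π))) ∧
      ((L / (2 * π) : ℝ) : ℂ) * ∫ v : ℝ, (n : ℂ) ^ (-(v * I)) * Ghat (v * L / (2 * π)) =
        G (Real.log n / L) := by
  have hpi := Real.pi_pos
  have hGhat' : Ghat = 𝓕⁻ G := by
    ext ξ
    rw [hGhat, Real.fourierInv_eq']
    refine integral_congr_ae (Filter.Eventually.of_forall fun u => ?_)
    simp only [smul_eq_mul, RCLike.inner_apply, conj_trivial]
    rw [mul_comm]
    congr 2
    push_cast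
    ring
  have hG1 : Integrable G := hG.continuous.integrable_of_hasCompactSupport hGsupp
  have hF := integrable_fourier_of_contDiff_two hG hGsupp
  have hFinv : Integrable Ghat := by
    rw [hGhat']
    convert hF.comp_neg using 2 with w
    exact Real.fourierInv_eq_fourier_neg _ _
  set c : ℝ := L / (2 * π) with hc
  have hcpos : 0 < c := by positivity
  set y : ℝ := Real.log n / L with hy
  set g : ℝ → ℂ := fun w => Real.fourierChar (-(w * y)) • Ghat w with hg
  have hgc : (fun v : ℝ => (n : ℂ) ^ (-(v * I)) * Ghat (v * L / (2 * π))) = fun v => g (v * c) := by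
    ext v
    simp only [hg, hc, hy, Circle.smul_def, Real.fourierChar_apply, smul_eq_mul]
    rw [Complex.cpow_def_of_ne_zero (Nat.cast_ne_zero.2 hn), ← Complex.natCast_log, mul_div_assoc]
    congr 2
    have hLc : (L : ℂ) ≠ 0 := Complex.ofReal_ne_zero.2 hL.ne'
    push_cast
    field_simp
  have hgint : Integrable g := by
    have := (Real.fourierIntegral_convergent_iff (μ := volume) (f := Ghat) y).2 hFinv
    simpa [hg, mul_comm] using this
  rw [hgc]
  refine ⟨hgint.comp_mul_right' hcpos.ne', ?_⟩
  rw [Measure.integral_comp_mul_right, abs_of_pos (inv_pos.2 hcpos), Complex.real_smul,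
    ← mul_assoc, ← Complex.ofReal_mul, mul_inv_cancel₀ hcpos.ne', Complex.ofReal_one, one_mul,
    hg, ← Real.fourier_real_eq, hGhat',
    Continuous.fourier_fourierInv_eq hG.continuous hG1 hF]

/-- **Squared Dirichlet polynomial identity.** Since `c(n) = ∑_{n=ab, a,b≤x} d_{1/2}(a)d_{1/2}(b)`
equals `1` for `n ≤ x` and `G` vanishes on `(1,∞)`, the smoothed series `∑ χ(n)n^{-s}G(log n/log x)`
equals an integral of the square of the Dirichlet polynomial `∑_{a≤x} d_{1/2}(a)χ(a)a^{-s-iv}`. -/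
theorem smoothed_series_eq_square_of_dirichlet_polynomial
    (G : ℝ → ℂ) (hG : ContDiff ℝ 2 G) (hGsupp : HasCompactSupport G)
    (hGvanish : ∀ u : ℝ, 1 < u → G u = 0)
    (Ghat : ℝ → ℂ)
    (hGhat : ∀ ξ : ℝ, Ghat ξ = ∫ u : ℝ, G u * Complex.exp (2 * (π : ℂ) * I * u * ξ))
    (q : ℕ) (hq : 1 ≤ q) (χ : DirichletCharacter ℂ q) (x : ℝ) (hx : 1 < x) (s : ℂ) :
    MeasureTheory.Integrable (fun v : ℝ =>
      (∑ a ∈ Finset.Icc 1 ⌊x⌋₊,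
          (dHalf a : ℂ) * χ ((a : ZMod q)) * (a : ℂ) ^ (-(s + v * I))) ^ 2 *
        Ghat (v * Real.log x / (2 * π))) ∧
    (∑' n : ℕ,
      if 1 ≤ n then χ ((n : ZMod q)) * (n : ℂ) ^ (-s) * G (Real.log n / Real.log x)
      else 0) =
    ((Real.log x / (2 * π) : ℝ) : ℂ) * ∫ v : ℝ,
      (∑ a ∈ Finset.Icc 1 ⌊x⌋₊,
          (dHalf a : ℂ) * χ ((a : ZMod q)) * (a : ℂ) ^ (-(s + v * I))) ^ 2 *
        Ghat (v * Real.log x / (2 * π)) := by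
  have hL : 0 < Real.log x := Real.log_pos hx
  set L := Real.log x with hLdef
  set N := ⌊x⌋₊ with hN
  set f : ℕ → ℂ := fun n => χ ((n : ZMod q)) * (n : ℂ) ^ (-s) * G (Real.log n / L) with hf
  have hfN (n : ℕ) (hn : N < n) : f n = 0 := by
    have hxn : x < n := (Nat.floor_lt (by linarith)).1 hn
    have : 1 < Real.log n / L := (one_lt_div hL).2 (Real.log_lt_log (by linarith) hxn)
    simp only [hf, hGvanish _ this, mul_zero]
  have hpair {a b : ℕ} (ha : a ∈ Finset.Icc 1 N) (hb : b ∈ Finset.Icc 1 N) :=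
    integrable_and_integral_natCast_cpow_mul hG hGsupp hGhat hL
      (mul_ne_zero (Nat.one_le_iff_ne_zero.1 (Finset.mem_Icc.1 ha).1)
        (Nat.one_le_iff_ne_zero.1 (Finset.mem_Icc.1 hb).1))
  let coeff : ℕ → ℕ → ℂ := fun a b => (dHalf a : ℂ) * dHalf b *
    (χ (((a * b : ℕ) : ZMod q)) * ((a * b : ℕ) : ℂ) ^ (-s))
  have hexpand : (fun v : ℝ =>
      (∑ a ∈ Finset.Icc 1 N,
          (dHalf a : ℂ) * χ ((a : ZMod q)) * (a : ℂ) ^ (-(s + v * I))) ^ 2 *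
        Ghat (v * L / (2 * π))) = fun v : ℝ =>
      ∑ a ∈ Finset.Icc 1 N, ∑ b ∈ Finset.Icc 1 N,
        coeff a b * (((a * b : ℕ) : ℂ) ^ (-(v * I)) * Ghat (v * L / (2 * π))) := by
    ext v
    rw [sq, Finset.sum_mul_sum, Finset.sum_mul]
    refine Finset.sum_congr rfl fun a ha => ?_
    rw [Finset.sum_mul]
    refine Finset.sum_congr rfl fun b hb => ?_
    have ha0 : (a : ℂ) ≠ 0 :=
      Nat.cast_ne_zero.2 (Nat.one_le_iff_ne_zero.1 (Finset.mem_Icc.1 ha).1)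
    have hb0 : (b : ℂ) ≠ 0 :=
      Nat.cast_ne_zero.2 (Nat.one_le_iff_ne_zero.1 (Finset.mem_Icc.1 hb).1)
    simp only [coeff, Nat.cast_mul, map_mul, Complex.natCast_mul_natCast_cpow, neg_add,
      Complex.cpow_add _ _ ha0, Complex.cpow_add _ _ hb0]
    ring
  have hterm {a b : ℕ} (ha : a ∈ Finset.Icc 1 N) (hb : b ∈ Finset.Icc 1 N) :=
    (hpair ha hb).1.const_mul (coeff a b)
  rw [hexpand]
  refine ⟨MeasureTheory.integrable_finsetSum _ fun a ha =>
    MeasureTheory.integrable_finsetSum _ fun b hb => hterm ha hb, ?_⟩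
  have hlhs : (∑' n : ℕ, if 1 ≤ n then f n else 0) = ∑ n ∈ Finset.Icc 1 N, f n := by
    rw [tsum_eq_sum (s := Finset.Icc 1 N)]
    · exact Finset.sum_congr rfl fun n hn => if_pos (Finset.mem_Icc.1 hn).1
    · intro n hn
      split_ifs with h1
      · exact hfN n (by simpa [h1] using hn)
      · rfl
  rw [hlhs, ← sum_Icc_sum_Icc_dHalf_mul N f hfN,
    MeasureTheory.integral_finsetSum _ fun a ha =>
      MeasureTheory.integrable_finsetSum _ fun b hb => hterm ha hb, Finset.mul_sum]
  refine Finset.sum_congr rfl fun a ha => ?_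
  rw [MeasureTheory.integral_finsetSum _ fun b hb => hterm ha hb, Finset.mul_sum]
  refine Finset.sum_congr rfl fun b hb => ?_
  rw [MeasureTheory.integral_const_mul, mul_left_comm (Complex.ofReal _), (hpair ha hb).2]
  simp only [coeff, hf]
  ring
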